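/- In the additive OMAC setup with agents arriving in order 1, …, n, let S¹ be the final hired set of the algorithm BP. If an agent i of quality group Q_x satisfies α(N̄_i) < b(N, x), where N̄_i is the set of agents of N appearing up to and including i when N is sorted in decreasing order of quality (ties broken by nondecreasing share), then i ∈ S¹; that is, BP never dismisses such an agent. -/

import Mathlib

open Finset

attribute [local instance] Classical.propDecidable

noncomputable section

/-- Total share `α(S)` of a team `S`. -/
def shareSum {ι : Type} (a : ι → ℝ) (S : Finset ι) : ℝ := ∑ i ∈ S, a i

/-- Total value `f(S)` of a team `S` (additive reward). -/
def valSum {ι : Type} (f : ι → ℝ) (S : Finset ι) : ℝ := ∑ i ∈ S, f i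

/-- The principal's utility `g(S) = (1 − α(S))·f(S)`. -/
def gUtil {ι : Type} (f a : ι → ℝ) (S : Finset ι) : ℝ :=
  (1 - shareSum a S) * valSum f S

/-- `S^{x-1}`: the agents of `S` belonging to quality groups strictly before `x`. -/
def belowSet {ι : Type} [DecidableEq ι] {p : ℕ} (grp : ι → Fin p) (S : Finset ι)
    (x : Fin p) : Finset ι :=
  S.filter (fun i => grp i < x)

/-- The balance point `b(S,x) = (1/2)·(1 + α(S^{x−1}) − f(S^{x−1})/q^x)`. -/
def balPt {ι : Type} [DecidableEq ι] {p : ℕ} (f a : ι → ℝ)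
    (grp : ι → Fin p) (qv : Fin p → ℝ) (S : Finset ι) (x : Fin p) : ℝ :=
  (1 / 2) * (1 + shareSum a (belowSet grp S x) - valSum f (belowSet grp S x) / qv x)

/-- The sorting order used by BP: decreasing quality (increasing group index),
ties broken by nondecreasing share, remaining ties by arrival index. -/
def ordR {n p : ℕ} (grp : Fin n → Fin p) (a : Fin n → ℝ) (i j : Fin n) : Prop :=
  grp i < grp j ∨ (grp i = grp j ∧ (a i < a j ∨ (a i = a j ∧ i ≤ j)))

/-- Insert an agent into a list sorted by `ordR`, keeping it sorted. -/
def insertSorted {n p : ℕ} (grp : Fin n → Fin p) (a : Fin n → ℝ) (i : Fin n) :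
    List (Fin n) → List (Fin n)
  | [] => [i]
  | j :: L => if ordR grp a i j then i :: j :: L else j :: insertSorted grp a i L

/-- The filtering pass of BP-STEP: scan the sorted list, keeping an agent `i` of
group `x` iff adding it keeps the accumulated share strictly below the balance
point `b(T, x)` of the accumulated set `T`. Returns the kept agents in order. -/
def bpFilter {n p : ℕ} (f a : Fin n → ℝ) (grp : Fin n → Fin p) (qv : Fin p → ℝ) :
    List (Fin n) → Finset (Fin n) → List (Fin n)
  | [], _ => []
  | i :: L, T =>
    if shareSum a (insert i T) < balPt f a grp qv T (grp i) then
      i :: bpFilter f a grp qv L (insert i T)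
    else
      bpFilter f a grp qv L T

/-- BP-STEP: upon arrival of agent `j` with current hired list `L` (sorted), sort
`L ∪ {j}` and re-run the balance-point filtering pass starting from `∅`. -/
def bpStep {n p : ℕ} (f a : Fin n → ℝ) (grp : Fin n → Fin p) (qv : Fin p → ℝ)
    (L : List (Fin n)) (j : Fin n) : List (Fin n) :=
  bpFilter f a grp qv (insertSorted grp a j L) ∅

/-- The final hired set `S¹` of the algorithm BP after processing all agents
`1, …, n` in arrival order. -/
def bpFinal {n p : ℕ} (f a : Fin n → ℝ) (grp : Fin n → Fin p) (qv : Fin p → ℝ) :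
    Finset (Fin n) :=
  ((List.finRange n).foldl (bpStep f a grp qv) []).toFinset

end

theorem balPt_anti {n p : ℕ} {f a : Fin n → ℝ} {qv : Fin p → ℝ} {grp : Fin n → Fin p}
    (ha : ∀ i, 0 < a i) (hqv : ∀ x, 0 < qv x) (hanti : StrictAnti qv)
    (hqual : ∀ i, f i = qv (grp i) * a i) {S T : Finset (Fin n)} (hST : S ⊆ T) (x : Fin p) :
    balPt f a grp qv T x ≤ balPt f a grp qv S x := by
  have hsum : ∀ U : Finset (Fin n), balPt f a grp qv U x =
      (1 / 2) * (1 - ∑ i ∈ belowSet grp U x, (f i / qv x - a i)) := by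
    intro U
    rw [Finset.sum_sub_distrib, ← Finset.sum_div]
    unfold balPt shareSum valSum
    ring
  have hle : ∑ i ∈ belowSet grp S x, (f i / qv x - a i) ≤
      ∑ i ∈ belowSet grp T x, (f i / qv x - a i) := by
    refine Finset.sum_le_sum_of_subset_of_nonneg (Finset.filter_subset_filter _ hST) ?_
    intro i hi _
    have hlt : grp i < x := (Finset.mem_filter.mp hi).2
    rw [sub_nonneg, le_div_iff₀ (hqv x), hqual i, mul_comm]
    exact mul_le_mul_of_nonneg_right (hanti hlt).le (ha i).le
  rw [hsum, hsum]
  linarith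

theorem ordR_refl {n p : ℕ} (grp : Fin n → Fin p) (a : Fin n → ℝ) (i : Fin n) :
    ordR grp a i i :=
  Or.inr ⟨rfl, Or.inr ⟨rfl, le_rfl⟩⟩

theorem ordR_total {n p : ℕ} (grp : Fin n → Fin p) (a : Fin n → ℝ) (i j : Fin n) :
    ordR grp a i j ∨ ordR grp a j i := by
  unfold ordR
  grind

theorem ordR_trans {n p : ℕ} {grp : Fin n → Fin p} {a : Fin n → ℝ} {i j k : Fin n}
    (hij : ordR grp a i j) (hjk : ordR grp a j k) : ordR grp a i k := by
  unfold ordR at *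
  grind

theorem mem_insertSorted {n p : ℕ} {grp : Fin n → Fin p} {a : Fin n → ℝ} {i k : Fin n}
    {L : List (Fin n)} : k ∈ insertSorted grp a i L ↔ k = i ∨ k ∈ L := by
  induction L with
  | nil => simp [insertSorted]
  | cons j L ih =>
    unfold insertSorted
    split_ifs
    · simp
    · simp only [List.mem_cons, ih]
      tauto

theorem pairwise_insertSorted {n p : ℕ} {grp : Fin n → Fin p} {a : Fin n → ℝ} (i : Fin n)
    {L : List (Fin n)} (hL : L.Pairwise (ordR grp a)) :
    (insertSorted grp a i L).Pairwise (ordR grp a) := by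
  induction L with
  | nil => simp [insertSorted]
  | cons j L ih =>
    obtain ⟨hj, hL'⟩ := List.pairwise_cons.mp hL
    unfold insertSorted
    split_ifs with h
    · refine List.pairwise_cons.mpr ⟨fun k hk => ?_, hL⟩
      rcases List.mem_cons.mp hk with rfl | hk
      · exact h
      · exact ordR_trans h (hj k hk)
    · refine List.pairwise_cons.mpr ⟨fun k hk => ?_, ih hL'⟩
      rcases mem_insertSorted.mp hk with rfl | hk
      · exact (ordR_total grp a k j).resolve_left h
      · exact hj k hk

theorem bpFilter_sublist {n p : ℕ} (f a : Fin n → ℝ) (grp : Fin n → Fin p) (qv : Fin p → ℝ)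
    (L : List (Fin n)) (T : Finset (Fin n)) : (bpFilter f a grp qv L T).Sublist L := by
  induction L generalizing T with
  | nil => simp [bpFilter]
  | cons j L ih =>
    unfold bpFilter
    split_ifs
    · exact (ih _).cons_cons j
    · exact (ih _).cons j

/-- The filtering pass keeps an agent that passes the test against every set of agents
preceding it in the sorting order. -/
theorem mem_bpFilter {n p : ℕ} {f a : Fin n → ℝ} {grp : Fin n → Fin p} {qv : Fin p → ℝ}
    {i : Fin n}
    (hi : ∀ T : Finset (Fin n), (∀ j ∈ T, ordR grp a j i) →
      shareSum a (insert i T) < balPt f a grp qv T (grp i))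
    {L : List (Fin n)} (hL : L.Pairwise (ordR grp a)) (hiL : i ∈ L)
    {T : Finset (Fin n)} (hT : ∀ j ∈ T, ordR grp a j i) : i ∈ bpFilter f a grp qv L T := by
  induction L generalizing T with
  | nil => simp at hiL
  | cons j L ih =>
    obtain ⟨hj, hL'⟩ := List.pairwise_cons.mp hL
    unfold bpFilter
    by_cases hij : i = j
    · subst hij
      rw [if_pos (hi T hT)]
      exact List.mem_cons_self
    · have hiL' : i ∈ L := (List.mem_cons.mp hiL).resolve_left hij
      split_ifs
      · refine List.mem_cons_of_mem _ (ih hL' hiL' fun k hk => ?_)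
        rcases Finset.mem_insert.mp hk with rfl | hk
        · exact hj i hiL'
        · exact hT k hk
      · exact ih hL' hiL' hT

theorem mem_foldl_bpStep {n p : ℕ} {f a : Fin n → ℝ} {grp : Fin n → Fin p} {qv : Fin p → ℝ}
    {i : Fin n}
    (hi : ∀ T : Finset (Fin n), (∀ j ∈ T, ordR grp a j i) →
      shareSum a (insert i T) < balPt f a grp qv T (grp i))
    (l : List (Fin n)) {L : List (Fin n)} (hL : L.Pairwise (ordR grp a)) (hil : i ∈ l ∨ i ∈ L) :
    i ∈ l.foldl (bpStep f a grp qv) L := by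
  induction l generalizing L with
  | nil => simpa using hil
  | cons j l ih =>
    have hsorted := pairwise_insertSorted j hL
    refine ih (hsorted.sublist (bpFilter_sublist f a grp qv _ _)) ?_
    by_cases hmem : i ∈ l
    · exact Or.inl hmem
    · refine Or.inr (mem_bpFilter hi hsorted (mem_insertSorted.mpr ?_) (by simp))
      simp only [List.mem_cons] at hil
      tauto

/-- In the additive OMAC setup with agents arriving in order
`1, …, n`, let `S¹` be the final hired set of the algorithm BP. If an agent `i`
of quality group `Q_x` satisfies `α(N̄_i) < b(N, x)` — where `N̄_i` is the set of
agents of `N` appearing up to and including `i` when `N` is sorted in decreasing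
order of quality (ties broken by nondecreasing share) — then `i ∈ S¹`; that is,
BP never dismisses such an agent. -/
theorem bp_never_dismisses_below_balance_point {n p : ℕ}
    (f a : Fin n → ℝ) (qv : Fin p → ℝ) (grp : Fin n → Fin p)
    (hf : ∀ i, 0 < f i) (ha : ∀ i, 0 < a i)
    (hqv : ∀ x, 0 < qv x) (hanti : StrictAnti qv)
    (hqual : ∀ i, f i = qv (grp i) * a i)
    (i : Fin n)
    (hcross : shareSum a (Finset.univ.filter (fun j => ordR grp a j i)) <
      balPt f a grp qv Finset.univ (grp i)) :
    i ∈ bpFinal f a grp qv := by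
  refine List.mem_toFinset.mpr
    (mem_foldl_bpStep ?_ _ List.Pairwise.nil (Or.inl (List.mem_finRange i)))
  intro T hT
  have hsub : insert i T ⊆ Finset.univ.filter (fun j => ordR grp a j i) := by
    intro j hj
    refine Finset.mem_filter.mpr ⟨Finset.mem_univ j, ?_⟩
    rcases Finset.mem_insert.mp hj with rfl | hj
    · exact ordR_refl grp a j
    · exact hT j hj
  calc shareSum a (insert i T)
      ≤ shareSum a (Finset.univ.filter (fun j => ordR grp a j i)) :=
        Finset.sum_le_sum_of_subset_of_nonneg hsub fun j _ _ => (ha j).le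
    _ < balPt f a grp qv Finset.univ (grp i) := hcross
    _ ≤ balPt f a grp qv T (grp i) :=
        balPt_anti ha hqv hanti hqual (Finset.subset_univ T) (grp i)
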